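/- arXiv:2406.18466 — 5 statements merged into one kernel-verified Lean document; each statement's English description precedes it below -/
import Mathlib

section
/- Let d ≥ 1 and let μ be any distribution on Q_d with w_i^0 > 1/2 for all i ∈ {1,...,d}. If (A,B) is an equilibrium for the two-player Voronoi game on Q_d with distribution μ, then A = B = 𝟎. -/
open Finset

/-- Hamming distance on the hypercube `{0,1}^d` (modelled as `Fin d → Bool`). -/
def hamming {d : ℕ} (X Y : Fin d → Bool) : ℕ :=
  (Finset.univ.filter (fun i => X i ≠ Y i)).card

/-- Number of 1-coordinates of a point of the hypercube. -/
def nOnes {d : ℕ} (X : Fin d → Bool) : ℕ :=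
  (Finset.univ.filter (fun i => X i = true)).card

/-- `μ` is a probability distribution on the hypercube. -/
def IsDistribution {d : ℕ} (μ : (Fin d → Bool) → ℝ) : Prop :=
  (∀ X, 0 ≤ μ X) ∧ ∑ X : Fin d → Bool, μ X = 1

open Classical in
/-- The weight of a set of points under `μ`. -/
noncomputable def wt {d : ℕ} (μ : (Fin d → Bool) → ℝ) (S : Set (Fin d → Bool)) : ℝ :=
  ∑ X : Fin d → Bool, if X ∈ S then μ X else 0

/-- Payoff to player 1, positioned at `A`, against player 2 positioned at `B`. -/
noncomputable def P1 {d : ℕ} (μ : (Fin d → Bool) → ℝ) (A B : Fin d → Bool) : ℝ :=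
  wt μ {X | hamming X A < hamming X B} + (1/2) * wt μ {X | hamming X A = hamming X B}

/-- Payoff to player 2, positioned at `B`, against player 1 positioned at `A`. -/
noncomputable def P2 {d : ℕ} (μ : (Fin d → Bool) → ℝ) (A B : Fin d → Bool) : ℝ :=
  wt μ {X | hamming X B < hamming X A} + (1/2) * wt μ {X | hamming X A = hamming X B}

/-- `(A,B)` is an equilibrium: neither player can strictly improve by moving. -/
def IsEquilibrium {d : ℕ} (μ : (Fin d → Bool) → ℝ) (A B : Fin d → Bool) : Prop :=
  (∀ A', P1 μ A' B ≤ P1 μ A B) ∧ (∀ B', P2 μ A B' ≤ P2 μ A B)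

/-- `w_i^0`: the weight of the subcube where coordinate `i` equals 0. -/
noncomputable def w0 {d : ℕ} (μ : (Fin d → Bool) → ℝ) (i : Fin d) : ℝ :=
  wt μ {X | X i = false}

/-- The all-zeros point `𝟎`. -/
def zeroPt (d : ℕ) : Fin d → Bool := fun _ => false

/-- The all-ones point `𝟏`. -/
def onePt (d : ℕ) : Fin d → Bool := fun _ => true

theorem wt_nonneg {d : ℕ} {μ : (Fin d → Bool) → ℝ} (hμ : ∀ X, 0 ≤ μ X)
    (S : Set (Fin d → Bool)) : 0 ≤ wt μ S := by
  unfold wt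
  exact Finset.sum_nonneg fun X _ => by split_ifs <;> simp [hμ X]

theorem wt_mono {d : ℕ} {μ : (Fin d → Bool) → ℝ} (hμ : ∀ X, 0 ≤ μ X)
    {S T : Set (Fin d → Bool)} (hST : S ⊆ T) : wt μ S ≤ wt μ T := by
  unfold wt
  refine Finset.sum_le_sum fun X _ => ?_
  by_cases hS : X ∈ S
  · simp [hS, hST hS]
  · rw [if_neg hS]
    split_ifs <;> simp [hμ X]

theorem P2_eq_P1_swap {d : ℕ} (μ : (Fin d → Bool) → ℝ) (A B : Fin d → Bool) :
    P2 μ A B = P1 μ B A := by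
  simp only [P1, P2, eq_comm]

/-- The game is constant-sum. -/
theorem P1_add_P1_swap {d : ℕ} {μ : (Fin d → Bool) → ℝ} (hμ : IsDistribution μ)
    (A B : Fin d → Bool) : P1 μ A B + P1 μ B A = 1 := by
  rw [← hμ.2]
  unfold P1 wt
  simp only [Finset.mul_sum, ← Finset.sum_add_distrib, Set.mem_ofPred_eq]
  refine Finset.sum_congr rfl fun X _ => ?_
  rcases lt_trichotomy (hamming X A) (hamming X B) with h | h | h
  · simp [h, h.ne, h.ne', h.not_gt]
  · simp only [h, lt_irrefl, if_true, if_false]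
    ring
  · simp [h, h.ne, h.ne', h.not_gt]

theorem hamming_update_lt {d : ℕ} {X B : Fin d → Bool} {i : Fin d}
    (hX : X i = false) (hB : B i = true) :
    hamming X (Function.update B i false) < hamming X B := by
  unfold hamming
  refine Finset.card_lt_card (Finset.ssubset_iff_of_subset ?_ |>.2 ⟨i, ?_, ?_⟩)
  · intro j hj
    by_cases hji : j = i
    · subst hji
      simp [hX] at hj
    · simpa [hji] using hj
  · simp [hX, hB]
  · simp [hX]

/-- Against a point with a 1-coordinate, flipping that coordinate to 0 captures at least the
weight of the corresponding subcube. -/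
theorem w0_le_P1_update {d : ℕ} {μ : (Fin d → Bool) → ℝ} (hμ : ∀ X, 0 ≤ μ X)
    {B : Fin d → Bool} {i : Fin d} (hB : B i = true) :
    w0 μ i ≤ P1 μ (Function.update B i false) B := by
  have hsub : w0 μ i ≤ wt μ {X | hamming X (Function.update B i false) < hamming X B} :=
    wt_mono hμ fun X hX => hamming_update_lt hX hB
  have hties := wt_nonneg hμ {X | hamming X (Function.update B i false) = hamming X B}
  unfold P1
  linarith

/-- The all-zeros point is the only point that cannot be beaten. -/
theorem eq_zeroPt_of_forall_P1_le_half {d : ℕ} {μ : (Fin d → Bool) → ℝ}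
    (hμ : ∀ X, 0 ≤ μ X) (hw : ∀ i, (1:ℝ)/2 < w0 μ i) {B : Fin d → Bool}
    (hB : ∀ A, P1 μ A B ≤ 1/2) : B = zeroPt d := by
  funext i
  by_contra hi
  have hi' : B i = true := by simpa [zeroPt] using hi
  linarith [hw i, w0_le_P1_update hμ hi', hB (Function.update B i false)]

theorem statement_0 (d : ℕ) (hd : 1 ≤ d) (μ : (Fin d → Bool) → ℝ)
    (hμ : IsDistribution μ) (hw : ∀ i, (1:ℝ)/2 < w0 μ i)
    (A B : Fin d → Bool) (hAB : IsEquilibrium μ A B) :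
    A = zeroPt d ∧ B = zeroPt d := by
  obtain ⟨h₁, h₂⟩ := hAB
  simp only [P2_eq_P1_swap] at h₂
  have hsum := P1_add_P1_swap hμ A B
  have hA := P1_add_P1_swap hμ A A
  have hB := P1_add_P1_swap hμ B B
  have hhA := h₂ A
  have hhB := h₁ B
  exact ⟨eq_zeroPt_of_forall_P1_le_half hμ.1 hw fun B' => by linarith [h₂ B'],
    eq_zeroPt_of_forall_P1_le_half hμ.1 hw fun A' => by linarith [h₁ A']⟩
end

section
/- Let d ≥ 1 and let μ be a distribution on Q_d satisfying w_i^0 ≥ 3/4 − 1/(4d) for all i when d is odd, and w_i^0 ≥ 3/4 − 1/(4(d−1)) for all i when d is even (with d ≥ 2). Then the position (𝟎,𝟎) is an equilibrium for the two-player Voronoi game on Q_d with distribution μ. -/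
open Finset

/-- The number of coordinates in which both points equal 1. -/
def nCommonOnes {d : ℕ} (A X : Fin d → Bool) : ℕ :=
  (Finset.univ.filter (fun i => A i = true ∧ X i = true)).card

theorem hamming_zeroPt_add_nOnes {d : ℕ} (A X : Fin d → Bool) :
    hamming X (zeroPt d) + nOnes A = hamming X A + 2 * nCommonOnes A X := by
  simp only [hamming, nOnes, nCommonOnes, Finset.card_filter, Finset.mul_sum,
    ← Finset.sum_add_distrib]
  refine Finset.sum_congr rfl fun i _ => ?_
  cases hA : A i <;> cases hX : X i <;> simp [zeroPt]

theorem nOnes_le {d : ℕ} (A : Fin d → Bool) : nOnes A ≤ d := by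
  simpa [nOnes] using Finset.card_filter_le (Finset.univ : Finset (Fin d)) (fun i => A i = true)

theorem P1_self {d : ℕ} {μ : (Fin d → Bool) → ℝ} (hμ : IsDistribution μ) (A : Fin d → Bool) :
    P1 μ A A = 1 / 2 := by
  simp [P1, wt, hμ.2]

theorem sum_mul_nCommonOnes {d : ℕ} {μ : (Fin d → Bool) → ℝ} (hμ : IsDistribution μ)
    (A : Fin d → Bool) :
    ∑ X, μ X * nCommonOnes A X = ∑ i with A i = true, (1 - w0 μ i) := by
  have h (i : Fin d) : 1 - w0 μ i = ∑ X, if X i = true then μ X else 0 := by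
    rw [← hμ.2, w0, wt, ← Finset.sum_sub_distrib]
    refine Finset.sum_congr rfl fun X _ => ?_
    cases hX : X i <;> simp [hX]
  simp only [h]
  rw [Finset.sum_comm]
  refine Finset.sum_congr rfl fun X _ => ?_
  rw [← Finset.sum_filter, Finset.filter_filter, Finset.sum_const, nsmul_eq_mul, mul_comm]
  rfl

/-- A Markov-type bound on the payoff of a player deviating from the all-zeros point. -/
theorem mul_P1_zeroPt_le {d : ℕ} {μ : (Fin d → Bool) → ℝ} (hμ : IsDistribution μ)
    {A : Fin d → Bool} (hA : 0 < nOnes A) :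
    ((nOnes A / 2 + 1 : ℕ) : ℝ) * P1 μ A (zeroPt d) ≤ ∑ X, μ X * nCommonOnes A X := by
  rw [P1, wt, wt, Finset.mul_sum, ← Finset.sum_add_distrib, Finset.mul_sum]
  refine Finset.sum_le_sum fun X _ => ?_
  have hX := hμ.1 X
  have hd := hamming_zeroPt_add_nOnes A X
  simp only [Set.mem_ofPred_eq]
  rcases lt_trichotomy (hamming X A) (hamming X (zeroPt d)) with h | h | h
  · have hn : nOnes A / 2 + 1 ≤ nCommonOnes A X := by omega
    have hn' : ((nOnes A / 2 + 1 : ℕ) : ℝ) ≤ nCommonOnes A X := by exact_mod_cast hn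
    rw [if_pos h, if_neg h.ne]
    nlinarith
  · have hn : nOnes A / 2 + 1 ≤ 2 * nCommonOnes A X := by omega
    have hn' : ((nOnes A / 2 + 1 : ℕ) : ℝ) ≤ 2 * nCommonOnes A X := by exact_mod_cast hn
    rw [if_neg h.not_lt, if_pos h]
    nlinarith
  · rw [if_neg h.not_gt, if_neg h.ne']
    simpa using mul_nonneg hX (Nat.cast_nonneg (α := ℝ) (nCommonOnes A X))

theorem P1_zeroPt_le_half {d m : ℕ} {μ : (Fin d → Bool) → ℝ} (hμ : IsDistribution μ)
    (hm : Odd m) (hdm : d ≤ m + 1)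
    (hw : ∀ i, (3 : ℝ) / 4 - 1 / (4 * m) ≤ w0 μ i) (A : Fin d → Bool) :
    P1 μ A (zeroPt d) ≤ 1 / 2 := by
  rcases Nat.eq_zero_or_pos (nOnes A) with hA | hA
  · have : A = zeroPt d := by
      funext i
      simpa [zeroPt] using Finset.filter_eq_empty_iff.1 (Finset.card_eq_zero.1 hA) (Finset.mem_univ i)
    rw [this, P1_self hμ]
  have hmpos : (0 : ℝ) < m := by exact_mod_cast hm.pos
  have hmarkov := mul_P1_zeroPt_le hμ hA
  rw [sum_mul_nCommonOnes hμ] at hmarkov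
  have hsum : ∑ i with A i = true, (1 - w0 μ i) ≤ nOnes A * ((1 + 1 / m) / 4 : ℝ) := by
    rw [nOnes, ← nsmul_eq_mul]
    refine Finset.sum_le_card_nsmul _ _ _ fun i _ => ?_
    have h4 : (1 : ℝ) / (4 * m) = 1 / m / 4 := by rw [mul_comm, div_div]
    linarith [hw i]
  have hcount : nOnes A * (m + 1) ≤ 2 * (nOnes A / 2 + 1) * m := by
    have hle := nOnes_le A
    obtain ⟨j, hj⟩ := hm
    rcases Nat.even_or_odd' (nOnes A) with ⟨q, hq | hq⟩
    · have h : nOnes A / 2 = q := by omega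
      rw [h, hq]
      have : q ≤ m := by omega
      nlinarith
    · have h : nOnes A / 2 = q := by omega
      rw [h, hq]
      have : 2 * q + 1 ≤ m := by omega
      nlinarith
  have hreal : (nOnes A : ℝ) * ((1 + 1 / m) / 4) ≤ ((nOnes A / 2 + 1 : ℕ) : ℝ) * (1 / 2) := by
    have h : (nOnes A : ℝ) * (m + 1) ≤ 2 * ((nOnes A / 2 + 1 : ℕ) : ℝ) * m := by
      exact_mod_cast hcount
    have heq : (nOnes A : ℝ) * ((1 + 1 / m) / 4) = nOnes A * (m + 1) / (4 * m) := by
      field_simp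
    rw [heq, div_le_iff₀ (by positivity)]
    linarith
  exact le_of_mul_le_mul_left (hmarkov.trans (hsum.trans hreal)) (by positivity)

theorem statement_1 (d : ℕ) (hd : 1 ≤ d) (μ : (Fin d → Bool) → ℝ)
    (hμ : IsDistribution μ)
    (hodd : Odd d → ∀ i, (3:ℝ)/4 - 1/(4*d) ≤ w0 μ i)
    (heven : Even d → ∀ i, (3:ℝ)/4 - 1/(4*((d:ℝ)-1)) ≤ w0 μ i) :
    IsEquilibrium μ (zeroPt d) (zeroPt d) := by
  have key (A : Fin d → Bool) : P1 μ A (zeroPt d) ≤ 1 / 2 := by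
    rcases Nat.even_or_odd d with h | h
    · refine P1_zeroPt_le_half (m := d - 1) hμ (Nat.Even.sub_odd hd h odd_one) (by omega)
        (fun i => ?_) A
      rw [Nat.cast_sub hd, Nat.cast_one]
      exact heven h i
    · exact P1_zeroPt_le_half hμ h (by omega) (hodd h) A
  refine ⟨fun A => ?_, fun B => ?_⟩
  · rw [P1_self hμ]
    exact key A
  · rw [P2_eq_P1_swap, P2_eq_P1_swap, P1_self hμ]
    exact key B
end

section
/- Let μ be a distribution on Q_d and let k be odd with 1 ≤ k ≤ d. If there exists X ∈ Q_d with |X| = k and P1(X,𝟎) > 1/2, then there exists a coordinate i with x_i = 1 such that w_i^0 < 3/4 − 1/(4k). -/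
open Finset

/-- Number of 1-coordinates of `X` at which `Y` vanishes. -/
def nMissed {d : ℕ} (X Y : Fin d → Bool) : ℕ :=
  (univ.filter (fun i => X i = true ∧ Y i = false)).card

theorem nMissed_le_nOnes {d : ℕ} (X Y : Fin d → Bool) : nMissed X Y ≤ nOnes X :=
  card_le_card (monotone_filter_right univ fun _ _ h => h.1)

theorem hamming_add_nOnes {d : ℕ} (X Y : Fin d → Bool) :
    hamming Y X + nOnes X = hamming Y (zeroPt d) + 2 * nMissed X Y := by
  simp only [hamming, nOnes, nMissed, card_filter, mul_sum, ← sum_add_distrib]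
  refine sum_congr rfl fun i _ => ?_
  cases X i <;> cases Y i <;> simp [zeroPt]

theorem sum_w0_eq {d : ℕ} (μ : (Fin d → Bool) → ℝ) (X : Fin d → Bool) :
    ∑ i with X i = true, w0 μ i = ∑ Y, μ Y * nMissed X Y := by
  simp only [w0, wt, Set.mem_ofPred_eq]
  rw [sum_comm]
  refine sum_congr rfl fun Y _ => ?_
  rw [nMissed, ← filter_filter, card_filter, Nat.cast_sum, mul_sum]
  refine sum_congr rfl fun i _ => ?_
  split_ifs <;> simp

/-- Against `𝟎`, a point with an odd number of 1-coordinates never ties, and it wins exactly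
those points that miss fewer than half of these coordinates. -/
theorem P1_zeroPt_eq {d : ℕ} (μ : (Fin d → Bool) → ℝ) (X : Fin d → Bool) (hX : Odd (nOnes X)) :
    P1 μ X (zeroPt d) = ∑ Y, if 2 * nMissed X Y < nOnes X then μ Y else 0 := by
  obtain ⟨m, hm⟩ := hX
  simp only [P1, wt, Set.mem_ofPred_eq, mul_sum, ← sum_add_distrib]
  refine sum_congr rfl fun Y _ => ?_
  have h := hamming_add_nOnes X Y
  have htie : hamming Y X ≠ hamming Y (zeroPt d) := by omega
  have hwin : hamming Y X < hamming Y (zeroPt d) ↔ 2 * nMissed X Y < nOnes X := by omega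
  simp [htie, hwin]

theorem sum_w0_le {d : ℕ} {μ : (Fin d → Bool) → ℝ} (hμ : IsDistribution μ) (X : Fin d → Bool)
    (hX : Odd (nOnes X)) :
    ∑ i with X i = true, w0 μ i ≤ nOnes X - ((nOnes X : ℝ) + 1) / 2 * P1 μ X (zeroPt d) := by
  have hmass : (nOnes X : ℝ) = ∑ Y, μ Y * nOnes X := by rw [← sum_mul, hμ.2, one_mul]
  rw [sum_w0_eq, P1_zeroPt_eq μ X hX, mul_sum]
  nth_rewrite 1 [hmass]
  rw [← sum_sub_distrib]
  refine sum_le_sum fun Y _ => ?_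
  have hY := hμ.1 Y
  split_ifs with h
  · have h' : 2 * (nMissed X Y : ℝ) + 1 ≤ nOnes X := by exact_mod_cast h
    nlinarith
  · have h' : (nMissed X Y : ℝ) ≤ nOnes X := by exact_mod_cast nMissed_le_nOnes X Y
    nlinarith

theorem statement_2 (d k : ℕ) (hk : Odd k) (hk1 : 1 ≤ k) (hkd : k ≤ d)
    (μ : (Fin d → Bool) → ℝ) (hμ : IsDistribution μ)
    (X : Fin d → Bool) (hX : nOnes X = k) (hP : (1:ℝ)/2 < P1 μ X (zeroPt d)) :
    ∃ i : Fin d, X i = true ∧ w0 μ i < (3:ℝ)/4 - 1/(4*k) := by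
  subst hX
  by_contra! hcon
  have hlower : ∑ i with X i = true, ((3:ℝ)/4 - 1/(4*(nOnes X : ℝ))) ≤
      ∑ i with X i = true, w0 μ i :=
    sum_le_sum fun i hi => hcon i (mem_filter.1 hi).2
  rw [sum_const, nsmul_eq_mul, ← nOnes] at hlower
  have hpos : (0:ℝ) < nOnes X := by exact_mod_cast hk1
  have hval : (nOnes X : ℝ) * ((3:ℝ)/4 - 1/(4*(nOnes X : ℝ))) = (3 * nOnes X - 1) / 4 := by
    field_simp
  have hupper := sum_w0_le hμ X hk
  nlinarith
end

section
/- Let d = 5, let 0 < ε < 3/5, and let μ be the distribution on Q_5 defined by μ(X) = (1/16)(1−ε) + (3/8)ε if |X| = 0, μ(X) = (1/16)(1−ε) if |X| = 2, μ(X) = (1/16)(1−ε) + (1/8)ε if |X| = 4, and μ(X) = 0 otherwise. Then the two-player Voronoi game on Q_5 with distribution μ has no equilibrium. -/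
open Finset

/-- The sign comparing how close `X` is to `A` and to `B`: `1` if `A` wins `X`, `-1` if `B` does. -/
def winSign {d : ℕ} (A B X : Fin d → Bool) : ℤ :=
  if hamming X A < hamming X B then 1 else if hamming X A = hamming X B then 0 else -1

/-- The number of points of weight `k` won by `A` minus the number won by `B`. -/
def levelMargin {d : ℕ} (k : ℕ) (A B : Fin d → Bool) : ℤ :=
  ∑ X : Fin d → Bool, if nOnes X = k then winSign A B X else 0

lemma P1_eq_half_add {d : ℕ} (μ : (Fin d → Bool) → ℝ) (A B : Fin d → Bool) :
    P1 μ A B = (1/2) * ∑ X, μ X + (1/2) * ∑ X, μ X * winSign A B X := by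
  unfold P1 wt
  simp only [Finset.mul_sum, ← Finset.sum_add_distrib, Set.mem_ofPred_eq]
  refine Finset.sum_congr rfl fun X _ => ?_
  unfold winSign
  split_ifs <;> first | omega | (push_cast; ring)

lemma P2_eq_half_sub {d : ℕ} (μ : (Fin d → Bool) → ℝ) (A B : Fin d → Bool) :
    P2 μ A B = (1/2) * ∑ X, μ X - (1/2) * ∑ X, μ X * winSign A B X := by
  unfold P2 wt
  simp only [Finset.mul_sum, ← Finset.sum_add_distrib, ← Finset.sum_sub_distrib, Set.mem_ofPred_eq]
  refine Finset.sum_congr rfl fun X _ => ?_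
  unfold winSign
  split_ifs <;> first | omega | (push_cast; ring)

lemma winSign_self {d : ℕ} (A X : Fin d → Bool) : winSign A A X = 0 := by
  simp [winSign]

/-- At an equilibrium no deviation against `B` has a positive margin. -/
lemma IsEquilibrium.sum_winSign_nonpos {d : ℕ} {μ : (Fin d → Bool) → ℝ} {A B : Fin d → Bool}
    (h : IsEquilibrium μ A B) (A' : Fin d → Bool) : ∑ X, μ X * winSign A' B X ≤ 0 := by
  have h₁ := h.1 A'
  have h₂ := h.2 A
  rw [P1_eq_half_add, P1_eq_half_add] at h₁
  rw [P2_eq_half_sub, P2_eq_half_sub] at h₂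
  simp only [winSign_self, Int.cast_zero, mul_zero, Finset.sum_const_zero] at h₂
  linarith

lemma sum_mul_winSign_of_levels {d : ℕ} (a b c : ℝ) (A B : Fin d → Bool) :
    ∑ X : Fin d → Bool, (if nOnes X = 0 then a else if nOnes X = 2 then b
      else if nOnes X = 4 then c else 0) * winSign A B X =
    a * levelMargin 0 A B + b * levelMargin 2 A B + c * levelMargin 4 A B := by
  unfold levelMargin
  push_cast
  simp only [Finset.mul_sum, ← Finset.sum_add_distrib]
  refine Finset.sum_congr rfl fun X _ => ?_
  split_ifs <;> first | omega | simp

/-- The quantities `s` and `t` below are proportional to the margin of `A` over `B` under the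
distributions with `ε = 0` and `ε = 3/5`. -/
lemma exists_levelMargin_pos (B : Fin 5 → Bool) : ∃ A : Fin 5 → Bool,
    let s := levelMargin 0 A B + levelMargin 2 A B + levelMargin 4 A B
    let t := s + 9 * levelMargin 0 A B + 3 * levelMargin 4 A B
    0 ≤ s ∧ 0 ≤ t ∧ 0 < s + t := by
  revert B
  decide +kernel

theorem statement_11 (ε : ℝ) (hε0 : 0 < ε) (hε1 : ε < 3/5)
    (μ : (Fin 5 → Bool) → ℝ)
    (hμ : μ = fun X =>
      if nOnes X = 0 then (1/16) * (1 - ε) + (3/8) * ε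
      else if nOnes X = 2 then (1/16) * (1 - ε)
      else if nOnes X = 4 then (1/16) * (1 - ε) + (1/8) * ε
      else 0) :
    ∀ A B : Fin 5 → Bool, ¬ IsEquilibrium μ A B := by
  intro A B h
  obtain ⟨A', hs, ht, hst⟩ := exists_levelMargin_pos B
  have hle := h.sum_winSign_nonpos A'
  simp only [hμ, sum_mul_winSign_of_levels] at hle
  have hs' : (0 : ℝ) ≤ levelMargin 0 A' B + levelMargin 2 A' B + levelMargin 4 A' B := by
    exact_mod_cast hs
  have ht' : (0 : ℝ) ≤ levelMargin 0 A' B + levelMargin 2 A' B + levelMargin 4 A' B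
      + 9 * levelMargin 0 A' B + 3 * levelMargin 4 A' B := by
    exact_mod_cast ht
  have hst' : (0 : ℝ) < levelMargin 0 A' B + levelMargin 2 A' B + levelMargin 4 A' B
      + (levelMargin 0 A' B + levelMargin 2 A' B + levelMargin 4 A' B
        + 9 * levelMargin 0 A' B + 3 * levelMargin 4 A' B) := by
    exact_mod_cast hst
  rcases hs'.lt_or_eq with hpos | hzero
  · nlinarith [mul_pos hpos (sub_pos.2 hε1), mul_nonneg ht' hε0.le]
  · rw [← hzero] at hst' ht'
    nlinarith [mul_pos (show (0 : ℝ) < 9 * levelMargin 0 A' B + 3 * levelMargin 4 A' B by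
      linarith) hε0, congrArg (· * ε) hzero]
end

section
/- Let 0 < α < 1 and 0 < p_1 < 1/2 < p_2 < 1 with (1−α)(1−p_1) + α(1−p_2) > 1/2, and let μ be the mixed product distribution on Q_d given by μ(X) = (1−α)·p_1^{|X|}(1−p_1)^{d−|X|} + α·p_2^{|X|}(1−p_2)^{d−|X|}. Then at least one of the following holds: (i) 𝟎 is a best response to 𝟎 (and hence (𝟎,𝟎) is an equilibrium), or (ii) 𝟏 is a best response to 𝟎. Moreover, if α > 1/2 then there exists D such that for all d ≥ D case (ii) holds with P1(𝟏,𝟎) > 1/2 (so no equilibrium exists), while if α < 1/2 then there exists D such that for all d ≥ D case (i) holds. -/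
open Finset

/-- The mixed product distribution on `Q_d`: a `(1-α)`-weighted product measure with
parameter `p₁` mixed with an `α`-weighted product measure with parameter `p₂`. -/
noncomputable def mixMu (α p₁ p₂ : ℝ) (d : ℕ) : (Fin d → Bool) → ℝ :=
  fun X => (1-α) * p₁^(nOnes X) * (1-p₁)^(d - nOnes X)
         + α * p₂^(nOnes X) * (1-p₂)^(d - nOnes X)

/-- One step of the Markov operator of the walk on `ℤ` that moves up with probability `p`. -/
def walkStep (p : ℝ) (φ : ℤ → ℝ) : ℤ → ℝ :=
  fun z => p * φ (z + 1) + (1 - p) * φ (z - 1)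

/-- The share of a voter won by the player who is closer to her by `z`. -/
noncomputable def score (z : ℤ) : ℝ :=
  if 0 < z then 1 else if z = 0 then 1 / 2 else 0

/-- The weight of `X` under the product measure with parameter `p`. -/
def prodWeight {d : ℕ} (p : ℝ) (X : Fin d → Bool) : ℝ :=
  ∏ i, if X i then p else 1 - p

/-- The probability, with ties broken evenly, that a walk with up-probability `p` is positive
after `k` steps. -/
noncomputable def winProb (p : ℝ) (k : ℕ) : ℝ :=
  (walkStep p)^[k] score 0

theorem score_add_score_neg (z : ℤ) : score z + score (-z) = 1 := by
  unfold score
  rcases lt_trichotomy z 0 with h | h | h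
  · rw [if_neg (by omega), if_neg (by omega), if_pos (by omega)]; norm_num
  · subst h; norm_num
  · rw [if_pos h, if_neg (by omega), if_neg (by omega)]; norm_num

theorem iterate_walkStep_eq_sum (p : ℝ) (φ : ℤ → ℝ) (k : ℕ) (z : ℤ) :
    (walkStep p)^[k] φ z = ∑ ij ∈ antidiagonal k,
      (k.choose ij.1 : ℝ) * (p ^ ij.1 * (1 - p) ^ ij.2 * φ (z + ij.1 - ij.2)) := by
  induction k generalizing z with
  | zero => simp
  | succ k ih =>
    rw [Function.iterate_succ_apply', sum_antidiagonal_choose_succ_mul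
      (fun i j => p ^ i * (1 - p) ^ j * φ (z + i - j)), walkStep, ih, ih, mul_sum, mul_sum,
      add_comm]
    congr 1
    · refine sum_congr rfl fun ij _ => ?_
      rw [show z - 1 + (ij.1 : ℤ) - ij.2 = z + ij.1 - ((ij.2 + 1 : ℕ) : ℤ) by push_cast; ring]
      ring
    · refine sum_congr rfl fun ij h => ?_
      rw [show z + 1 + (ij.1 : ℤ) - ij.2 = z + ((ij.1 + 1 : ℕ) : ℤ) - ij.2 by push_cast; ring,
        Nat.choose_symm_of_eq_add (mem_antidiagonal.1 h).symm]
      ring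

theorem sum_prodWeight_mul (p : ℝ) {d : ℕ} (A : Fin d → Bool) (φ : ℤ → ℝ) (z : ℤ) :
    ∑ X : Fin d → Bool, prodWeight p X *
      φ (z + ∑ i, if A i then (if X i then 1 else -1) else 0) =
    (walkStep p)^[nOnes A] φ z := by
  induction d generalizing z with
  | zero => simp [prodWeight, nOnes]
  | succ d ih =>
    rw [← (Fin.consEquiv fun _ => Bool).sum_comp, Fintype.sum_prod_type, Fintype.sum_bool]
    have hA : nOnes A = (if A 0 then 1 else 0) + nOnes (Fin.tail A) := by
      rw [nOnes, nOnes, card_filter, card_filter, Fin.sum_univ_succ]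
      rfl
    have h := fun z => ih (Fin.tail A) z
    simp only [Fin.tail] at h hA
    cases h0 : A 0 <;>
      simp only [prodWeight, Fin.consEquiv, Equiv.coe_fn_mk, Fin.prod_univ_succ,
        Fin.sum_univ_succ, Fin.cons_zero, Fin.cons_succ, h0, if_true, Bool.false_eq_true,
        if_false, mul_assoc, ← mul_sum, ← add_assoc, zero_add] at h hA ⊢
    · refine (congrArg₂ (fun a b => p * a + (1 - p) * b) (h _) (h _)).trans ?_
      rw [hA]; ring
    · refine (congrArg₂ (fun a b => p * a + (1 - p) * b) (h _) (h _)).trans ?_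
      rw [hA, add_comm 1, Function.iterate_succ_apply', walkStep, sub_eq_add_neg z]

theorem hamming_sub_hamming {d : ℕ} (X A B : Fin d → Bool) :
    (hamming X B : ℤ) - hamming X A =
      ∑ i, ((if X i ≠ B i then 1 else 0) - (if X i ≠ A i then 1 else 0)) := by
  simp only [hamming, card_filter, Nat.cast_sum, Nat.cast_ite, Nat.cast_one, Nat.cast_zero,
    sum_sub_distrib]

theorem P1_eq_sum_score {d : ℕ} (μ : (Fin d → Bool) → ℝ) (A B : Fin d → Bool) :
    P1 μ A B = ∑ X, μ X * score ((hamming X B : ℤ) - hamming X A) := by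
  simp only [P1, wt, mul_sum, ← sum_add_distrib, Set.mem_ofPred_eq]
  refine sum_congr rfl fun X _ => ?_
  unfold score
  rcases lt_trichotomy (hamming X A) (hamming X B) with h | h | h
  · rw [if_pos h, if_neg h.ne, if_pos (by omega)]; ring
  · rw [if_neg h.not_lt, if_pos h, if_neg (by omega), if_pos (by omega)]; ring
  · rw [if_neg h.le.not_gt, if_neg h.ne', if_neg (by omega), if_neg (by omega)]; ring

theorem P1_add_P2 {d : ℕ} (μ : (Fin d → Bool) → ℝ) (A B : Fin d → Bool) :
    P1 μ A B + P2 μ A B = ∑ X, μ X := by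
  rw [P2_eq_P1_swap, P1_eq_sum_score, P1_eq_sum_score, ← sum_add_distrib]
  refine sum_congr rfl fun X _ => ?_
  rw [← mul_add, ← neg_sub (hamming X B : ℤ), score_add_score_neg, mul_one]

theorem pow_mul_pow_eq_prodWeight (p : ℝ) {d : ℕ} (X : Fin d → Bool) :
    p ^ nOnes X * (1 - p) ^ (d - nOnes X) = prodWeight p X := by
  have h := card_filter_add_card_filter_not (s := (univ : Finset (Fin d))) (fun i => X i = true)
  rw [card_univ, Fintype.card_fin] at h
  rw [prodWeight, prod_ite, prod_const, prod_const, nOnes]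
  congr 2
  omega

theorem mixMu_eq (α p₁ p₂ : ℝ) {d : ℕ} (X : Fin d → Bool) :
    mixMu α p₁ p₂ d X = (1 - α) * prodWeight p₁ X + α * prodWeight p₂ X := by
  rw [mixMu, mul_assoc, mul_assoc, pow_mul_pow_eq_prodWeight, pow_mul_pow_eq_prodWeight]

theorem sum_mixMu_mul (α p₁ p₂ : ℝ) {d : ℕ} (f : (Fin d → Bool) → ℝ) :
    ∑ X, mixMu α p₁ p₂ d X * f X =
      (1 - α) * ∑ X, prodWeight p₁ X * f X + α * ∑ X, prodWeight p₂ X * f X := by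
  simp only [mixMu_eq, mul_sum, ← sum_add_distrib, add_mul, mul_assoc]

theorem sum_prodWeight (p : ℝ) (d : ℕ) : ∑ X : Fin d → Bool, prodWeight p X = 1 := by
  simpa [nOnes, zeroPt] using sum_prodWeight_mul p (zeroPt d) (fun _ => 1) 0

theorem sum_mixMu (α p₁ p₂ : ℝ) (d : ℕ) : ∑ X, mixMu α p₁ p₂ d X = 1 := by
  simpa [sum_prodWeight] using sum_mixMu_mul α p₁ p₂ (d := d) (fun _ => 1)

theorem P1_mixMu_zeroPt (α p₁ p₂ : ℝ) {d : ℕ} (A : Fin d → Bool) :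
    P1 (mixMu α p₁ p₂ d) A (zeroPt d) =
      (1 - α) * winProb p₁ (nOnes A) + α * winProb p₂ (nOnes A) := by
  have h (X : Fin d → Bool) : (hamming X (zeroPt d) : ℤ) - hamming X A =
      0 + ∑ i, if A i then (if X i then 1 else -1) else 0 := by
    rw [hamming_sub_hamming, zero_add]
    refine sum_congr rfl fun i _ => ?_
    cases hX : X i <;> cases hA : A i <;> simp [zeroPt]
  rw [P1_eq_sum_score, sum_mixMu_mul]
  simp only [h, sum_prodWeight_mul, winProb]

theorem P1_mixMu_update_false (α p₁ p₂ : ℝ) {d : ℕ} (B : Fin d → Bool) (i : Fin d)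
    (hi : B i = true) :
    P1 (mixMu α p₁ p₂ d) (Function.update B i false) B =
      (1 - α) * (1 - p₁) + α * (1 - p₂) := by
  have h (X : Fin d → Bool) :
      (hamming X B : ℤ) - hamming X (Function.update B i false) =
        -(0 + ∑ j, if Function.update (zeroPt d) i true j then (if X j then 1 else -1) else 0) := by
    rw [hamming_sub_hamming, zero_add, ← sum_neg_distrib]
    refine sum_congr rfl fun j _ => ?_
    rcases eq_or_ne j i with rfl | hj
    · cases hX : X j <;> simp [hi]
    · simp [hj, zeroPt]
  have hn : nOnes (Function.update (zeroPt d) i true) = 1 := by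
    rw [nOnes, card_eq_one]
    refine ⟨i, ?_⟩
    ext j
    rcases eq_or_ne j i with rfl | hj <;> simp_all [zeroPt]
  rw [P1_eq_sum_score, sum_mixMu_mul]
  simp only [h, fun p => sum_prodWeight_mul p (Function.update (zeroPt d) i true)
    (fun z => score (-z)) 0, hn, Function.iterate_one, walkStep]
  norm_num [score]

theorem P1_self_eq_half (α p₁ p₂ : ℝ) {d : ℕ} (A : Fin d → Bool) :
    P1 (mixMu α p₁ p₂ d) A A = 1 / 2 := by
  have h := P1_add_P2 (mixMu α p₁ p₂ d) A A
  rw [P2_eq_P1_swap, sum_mixMu] at h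
  linarith

theorem winProb_succ_sub (p : ℝ) (k : ℕ) :
    winProb p (k + 1) - winProb p k =
      (if Even k then (k.choose (k / 2) : ℝ) / 2 else 0) *
        ((p * (1 - p)) ^ (k / 2) * (2 * p - 1)) := by
  rw [winProb, winProb, Function.iterate_succ_apply, iterate_walkStep_eq_sum,
    iterate_walkStep_eq_sum, ← sum_sub_distrib]
  have hfar (z : ℤ) (hz : z < -1 ∨ 1 < z) : walkStep p score z = score z := by
    unfold walkStep score
    rcases hz with hz | hz
    · rw [if_neg (by omega), if_neg (by omega), if_neg (by omega), if_neg (by omega),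
        if_neg (by omega), if_neg (by omega)]
      ring
    · rw [if_pos (by omega), if_pos (by omega), if_pos (by omega)]
      ring
  rcases Nat.even_or_odd' k with ⟨m, rfl | rfl⟩
  · rw [sum_eq_single_of_mem (m, m) (by simp [two_mul])]
    · norm_num [walkStep, score, mul_pow]
      ring
    · rintro ⟨i, j⟩ hij hne
      have hij' := mem_antidiagonal.1 hij
      rw [hfar, sub_self]
      by_contra hc
      apply hne
      ext <;> dsimp only at * <;> omega
  · rw [sum_eq_add_of_mem (m + 1, m) (m, m + 1) (by simp; ring) (by simp; ring) (by simp)]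
    · have hc : (2 * m + 1).choose (m + 1) = (2 * m + 1).choose m :=
        Nat.choose_symm_of_eq_add (by ring)
      have he : ¬ Even (2 * m + 1) := by simp
      rw [if_neg he]
      norm_num [walkStep, score, hc]
      ring
    · rintro ⟨i, j⟩ hij hne
      have hij' := mem_antidiagonal.1 hij
      rw [hfar, sub_self]
      by_contra hc
      simp only [ne_eq, Prod.mk.injEq] at hne
      dsimp only at *
      omega

theorem winProb_add_winProb_one_sub (p : ℝ) (k : ℕ) :
    winProb p k + winProb (1 - p) k = 1 := by
  suffices h : ∀ z, (walkStep p)^[k] score z + (walkStep (1 - p))^[k] score (-z) = 1 by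
    simpa [winProb] using h 0
  induction k with
  | zero => exact score_add_score_neg
  | succ k ih =>
    intro z
    have h1 := ih (z + 1)
    have h2 := ih (z - 1)
    rw [Function.iterate_succ_apply', Function.iterate_succ_apply', walkStep, walkStep,
      show -z + 1 = -(z - 1) by ring, show -z - 1 = -(z + 1) by ring]
    linear_combination p * h1 + (1 - p) * h2

theorem winProb_nonneg {p : ℝ} (h0 : 0 ≤ p) (h1 : p ≤ 1) (k : ℕ) : 0 ≤ winProb p k := by
  have hs (z : ℤ) : 0 ≤ score z := by unfold score; split_ifs <;> norm_num
  rw [winProb, iterate_walkStep_eq_sum]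
  have := sub_nonneg.2 h1
  exact sum_nonneg fun ij _ => mul_nonneg (by positivity) (mul_nonneg (by positivity) (hs _))

theorem winProb_le_pow {p : ℝ} (h0 : 0 < p) (h1 : p ≤ 1 / 2) (k : ℕ) :
    winProb p k ≤ (2 * √(p * (1 - p))) ^ k := by
  set r := √(p * (1 - p)) with hr
  have hq : 0 < 1 - p := by linarith
  have hrpos : 0 < r := Real.sqrt_pos.2 (mul_pos h0 hq)
  have hr2 : r * r = p * (1 - p) := Real.mul_self_sqrt (mul_pos h0 hq).le
  have hpr : p ≤ r := by nlinarith
  have ht : 1 ≤ r / p := (one_le_div h0).2 hpr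
  have ht0 : r / p ≠ 0 := by positivity
  suffices h : ∀ z, (walkStep p)^[k] score z ≤ (2 * r) ^ k * (r / p) ^ z by
    simpa [winProb] using h 0
  induction k with
  | zero =>
    intro z
    simp only [Function.iterate_zero, id, pow_zero, one_mul]
    unfold score
    split_ifs with hz hz
    · exact one_le_zpow₀ ht hz.le
    · subst hz; norm_num
    · positivity
  | succ k ih =>
    intro z
    rw [Function.iterate_succ_apply', walkStep]
    calc _ ≤ p * ((2 * r) ^ k * (r / p) ^ (z + 1)) + (1 - p) * ((2 * r) ^ k * (r / p) ^ (z - 1)) :=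
          add_le_add (mul_le_mul_of_nonneg_left (ih _) h0.le)
            (mul_le_mul_of_nonneg_left (ih _) hq.le)
      _ = _ := by
          rw [zpow_add_one₀ ht0, zpow_sub_one₀ ht0, pow_succ]
          have e1 : p * (r / p) = r := by field_simp
          have e2 : (1 - p) * (r / p)⁻¹ = r := by
            rw [inv_div]; field_simp; linarith
          linear_combination (2 * r) ^ k * (r / p) ^ z * (e1 + e2)

theorem tendsto_winProb_zero {p : ℝ} (h0 : 0 < p) (h1 : p < 1 / 2) :
    Filter.Tendsto (winProb p) Filter.atTop (nhds 0) := by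
  refine squeeze_zero (winProb_nonneg h0.le (by linarith)) (winProb_le_pow h0 h1.le)
    (tendsto_pow_atTop_nhds_zero_of_lt_one (by positivity) ?_)
  have : √(p * (1 - p)) < 1 / 2 := by
    rw [Real.sqrt_lt' (by norm_num)]
    nlinarith [mul_pos (sub_pos.2 h1) (sub_pos.2 h1)]
  linarith

theorem tendsto_winProb_one {p : ℝ} (h0 : 1 / 2 < p) (h1 : p < 1) :
    Filter.Tendsto (winProb p) Filter.atTop (nhds 1) := by
  have h := (tendsto_winProb_zero (p := 1 - p) (by linarith) (by linarith)).const_sub 1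
  rw [sub_zero] at h
  exact h.congr fun k => by linarith [winProb_add_winProb_one_sub p k]

theorem tendsto_mix_winProb (α : ℝ) {p₁ p₂ : ℝ} (hp1 : 0 < p₁) (hp2 : p₁ < 1 / 2)
    (hp3 : 1 / 2 < p₂) (hp4 : p₂ < 1) :
    Filter.Tendsto (fun k => (1 - α) * winProb p₁ k + α * winProb p₂ k) Filter.atTop
      (nhds α) := by
  simpa using ((tendsto_winProb_zero hp1 hp2).const_mul (1 - α)).add
    ((tendsto_winProb_one hp3 hp4).const_mul α)

/-- A sequence whose increments stay nonnegative once they are attains its maximum over an initial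
segment at an endpoint. -/
theorem le_left_or_le_right_of_succ_sub_eq_mul {F c h : ℕ → ℝ} (hc : ∀ k, 0 ≤ c k)
    (hF : ∀ k, F (k + 1) - F k = c k * h k) (hh : ∀ j k, j ≤ k → 0 ≤ h j → 0 ≤ h k)
    {k d : ℕ} (hkd : k ≤ d) : F k ≤ F 0 ∨ F k ≤ F d := by
  rcases le_or_gt 0 (h k) with hk | hk
  · right
    induction d, hkd using Nat.le_induction with
    | base => exact le_rfl
    | succ d hd ih => linarith [hF d, mul_nonneg (hc d) (hh k d hd hk)]
  · left
    have hneg : ∀ j ≤ k, h j < 0 := fun j hj => not_le.1 fun h0 => hk.not_ge (hh j k hj h0)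
    clear hkd hk
    induction k with
    | zero => exact le_rfl
    | succ k ih =>
      linarith [hF k, ih fun j hj => hneg j (by omega),
        mul_nonpos_of_nonneg_of_nonpos (hc k) (hneg k (by omega)).le]

theorem mul_pow_le_mul_pow_of_le {a b x y : ℝ} (hb : 0 < b) (hba : b < a) (hx : 0 < x)
    (hy : 0 < y) {j k : ℕ} (hjk : j ≤ k) (h : a * x ^ j ≤ b * y ^ j) :
    a * x ^ k ≤ b * y ^ k := by
  have hxy : x ≤ y := by
    by_contra! hlt
    have h1 : y ^ j ≤ x ^ j := pow_le_pow_left₀ hy.le hlt.le j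
    nlinarith [pow_pos hx j, mul_le_mul_of_nonneg_left h1 hb.le]
  obtain ⟨n, rfl⟩ := Nat.exists_eq_add_of_le hjk
  rw [pow_add, pow_add, ← mul_assoc, ← mul_assoc]
  exact mul_le_mul h (pow_le_pow_left₀ hx.le hxy n) (by positivity) (by positivity)

theorem P1_mixMu_zeroPt_le_half_or_le_onePt {α p₁ p₂ : ℝ} (hα0 : 0 < α) (hp1 : 0 < p₁)
    (hp2 : p₁ < 1 / 2) (hp3 : 1 / 2 < p₂) (hp4 : p₂ < 1)
    (hmaj : 1 / 2 < (1 - α) * (1 - p₁) + α * (1 - p₂)) {d : ℕ} (A : Fin d → Bool) :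
    P1 (mixMu α p₁ p₂ d) A (zeroPt d) ≤ 1 / 2 ∨
      P1 (mixMu α p₁ p₂ d) A (zeroPt d) ≤ P1 (mixMu α p₁ p₂ d) (onePt d) (zeroPt d) := by
  have hA : nOnes A ≤ d := by
    simpa [nOnes] using card_filter_le (univ : Finset (Fin d)) (fun i => A i = true)
  have hone : nOnes (onePt d) = d := by simp [nOnes, onePt]
  have hzero : nOnes (zeroPt d) = 0 := by simp [nOnes, zeroPt]
  rw [← P1_self_eq_half α p₁ p₂ (zeroPt d), P1_mixMu_zeroPt, P1_mixMu_zeroPt, P1_mixMu_zeroPt,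
    hone, hzero]
  refine le_left_or_le_right_of_succ_sub_eq_mul
    (F := fun k => (1 - α) * winProb p₁ k + α * winProb p₂ k)
    (c := fun k => if Even k then (k.choose (k / 2) : ℝ) / 2 else 0)
    (h := fun k => α * (2 * p₂ - 1) * (p₂ * (1 - p₂)) ^ (k / 2) -
      (1 - α) * (1 - 2 * p₁) * (p₁ * (1 - p₁)) ^ (k / 2)) ?_ ?_ ?_ hA
  · intro k
    split_ifs <;> positivity
  · intro k
    linear_combination (1 - α) * winProb_succ_sub p₁ k + α * winProb_succ_sub p₂ k
  · intro j k hjk h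
    rw [sub_nonneg] at h ⊢
    exact mul_pow_le_mul_pow_of_le (mul_pos hα0 (by linarith)) (by linarith)
      (mul_pos hp1 (by linarith)) (mul_pos (by linarith) (by linarith))
      (Nat.div_le_div_right hjk) h

theorem not_isEquilibrium_of_half_lt {α p₁ p₂ : ℝ}
    (hmaj : 1 / 2 < (1 - α) * (1 - p₁) + α * (1 - p₂)) {d : ℕ}
    (h : 1 / 2 < P1 (mixMu α p₁ p₂ d) (onePt d) (zeroPt d)) (A B : Fin d → Bool) :
    ¬ IsEquilibrium (mixMu α p₁ p₂ d) A B := by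
  rintro ⟨hA, hB⟩
  have hsum := P1_add_P2 (mixMu α p₁ p₂ d) A B
  rw [sum_mixMu] at hsum
  have hP2 := hB A
  rw [P2_eq_P1_swap _ A A, P1_self_eq_half] at hP2
  by_cases hBi : ∃ i, B i = true
  · obtain ⟨i, hi⟩ := hBi
    have := hA (Function.update B i false)
    rw [P1_mixMu_update_false _ _ _ _ _ hi] at this
    linarith
  · have hB0 : B = zeroPt d := funext fun i => by simpa [zeroPt] using fun hi => hBi ⟨i, hi⟩
    subst hB0
    linarith [hA (onePt d)]

theorem statement_19 (α p₁ p₂ : ℝ)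
    (hα0 : 0 < α) (hα1 : α < 1)
    (hp1 : 0 < p₁) (hp2 : p₁ < 1/2) (hp3 : (1:ℝ)/2 < p₂) (hp4 : p₂ < 1)
    (hmaj : (1:ℝ)/2 < (1-α) * (1-p₁) + α * (1-p₂)) :
    (∀ d : ℕ,
      (∀ A', P1 (mixMu α p₁ p₂ d) A' (zeroPt d) ≤ P1 (mixMu α p₁ p₂ d) (zeroPt d) (zeroPt d))
      ∨ (∀ A', P1 (mixMu α p₁ p₂ d) A' (zeroPt d) ≤ P1 (mixMu α p₁ p₂ d) (onePt d) (zeroPt d)))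
    ∧ ((1:ℝ)/2 < α → ∃ D : ℕ, ∀ d ≥ D,
        (1:ℝ)/2 < P1 (mixMu α p₁ p₂ d) (onePt d) (zeroPt d)
        ∧ (∀ A', P1 (mixMu α p₁ p₂ d) A' (zeroPt d) ≤ P1 (mixMu α p₁ p₂ d) (onePt d) (zeroPt d))
        ∧ ∀ A B : Fin d → Bool, ¬ IsEquilibrium (mixMu α p₁ p₂ d) A B)
    ∧ (α < (1:ℝ)/2 → ∃ D : ℕ, ∀ d ≥ D,
        ∀ A', P1 (mixMu α p₁ p₂ d) A' (zeroPt d) ≤ P1 (mixMu α p₁ p₂ d) (zeroPt d) (zeroPt d)) := by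
  have hone : ∀ d, nOnes (onePt d) = d := fun d => by simp [nOnes, onePt]
  have hlim := tendsto_mix_winProb α hp1 hp2 hp3 hp4
  have hdich := fun (d : ℕ) (A : Fin d → Bool) =>
    P1_mixMu_zeroPt_le_half_or_le_onePt hα0 hp1 hp2 hp3 hp4 hmaj A
  have hright (d : ℕ) (h : 1 / 2 ≤ P1 (mixMu α p₁ p₂ d) (onePt d) (zeroPt d))
      (A : Fin d → Bool) : P1 (mixMu α p₁ p₂ d) A (zeroPt d) ≤
        P1 (mixMu α p₁ p₂ d) (onePt d) (zeroPt d) :=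
    (hdich d A).elim (fun h' => h'.trans h) id
  have hleft (d : ℕ) (h : P1 (mixMu α p₁ p₂ d) (onePt d) (zeroPt d) ≤ 1 / 2)
      (A : Fin d → Bool) : P1 (mixMu α p₁ p₂ d) A (zeroPt d) ≤
        P1 (mixMu α p₁ p₂ d) (zeroPt d) (zeroPt d) := by
    rw [P1_self_eq_half]
    exact (hdich d A).elim id fun h' => h'.trans h
  refine ⟨fun d => ?_, fun hα => ?_, fun hα => ?_⟩
  · exact (le_total _ _).imp (hleft d) (hright d)
  · obtain ⟨D, hD⟩ := Filter.eventually_atTop.1 (hlim.eventually_const_lt hα)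
    refine ⟨D, fun d hd => ?_⟩
    have h : 1 / 2 < P1 (mixMu α p₁ p₂ d) (onePt d) (zeroPt d) := by
      rw [P1_mixMu_zeroPt, hone]
      exact hD d hd
    exact ⟨h, hright d h.le, not_isEquilibrium_of_half_lt hmaj h⟩
  · obtain ⟨D, hD⟩ := Filter.eventually_atTop.1 (hlim.eventually_lt_const hα)
    refine ⟨D, fun d hd => hleft d ?_⟩
    rw [P1_mixMu_zeroPt, hone]
    exact (hD d hd).le
end
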